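/- Let h be a nonzero real polynomial all of whose complex zeros lie in [-1,0], and let f be real-rooted. Then the polynomial f ★ h := Σ_{n≥0} (f⁽ⁿ⁾(x) g⁽ⁿ⁾(x)/n!) xⁿ(x+1)ⁿ (with g = h) is real-rooted or zero, and if g ⪯ f for real-rooted g, then g ★ h ⪯ f ★ h. -/

import Mathlib

open Polynomial

/-- A real polynomial is real-rooted if it is nonzero and all of its complex zeros are real. -/
def RealRooted (f : Polynomial ℝ) : Prop :=
  f ≠ 0 ∧ ∀ z : ℂ, (f.map (algebraMap ℝ ℂ)).IsRoot z → z.im = 0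

/-- The zeros of `f`, listed in increasing order (with multiplicity). -/
noncomputable def sortedRoots (f : Polynomial ℝ) : List ℝ :=
  f.roots.sort (· ≤ ·)

/-- `g ⪯ f`: interlacing. Both are real-rooted, `deg f = deg g + 1`, and listing the zeros of
`f` as `α₁ ≤ ⋯ ≤ α_d` and of `g` as `β₁ ≤ ⋯ ≤ β_{d-1}` (with multiplicity, in increasing
order), one has `α₁ ≤ β₁ ≤ α₂ ≤ ⋯ ≤ β_{d-1} ≤ α_d`. -/
def Interlaces (g f : Polynomial ℝ) : Prop :=
  RealRooted f ∧ RealRooted g ∧ f.natDegree = g.natDegree + 1 ∧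
  ∀ i, i < g.natDegree →
    (sortedRoots f).getD i 0 ≤ (sortedRoots g).getD i 0 ∧
    (sortedRoots g).getD i 0 ≤ (sortedRoots f).getD (i + 1) 0

/-- `g ≺ f`: strict interlacing, where all the inequalities above are strict. -/
def StrictInterlaces (g f : Polynomial ℝ) : Prop :=
  RealRooted f ∧ RealRooted g ∧ f.natDegree = g.natDegree + 1 ∧
  ∀ i, i < g.natDegree →
    (sortedRoots f).getD i 0 < (sortedRoots g).getD i 0 ∧
    (sortedRoots g).getD i 0 < (sortedRoots f).getD (i + 1) 0

/-- The product `f ★ g = Σₙ (f⁽ⁿ⁾ g⁽ⁿ⁾ / n!) xⁿ(x+1)ⁿ`. -/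
noncomputable def starProd (f g : Polynomial ℝ) : Polynomial ℝ :=
  ∑ n ∈ Finset.range (f.natDegree + 1),
    C ((n.factorial : ℝ)⁻¹) *
      (derivative^[n] f) * (derivative^[n] g) * (X * (X + 1)) ^ n

/-- The operator `f ↦ f ★ ∏ (X - a)`, the product running over the list, built one linear factor
at a time. -/
noncomputable def starOp (K : Type*) [Field K] [Algebra ℝ K] : List ℝ → K[X] →ₗ[K] K[X]
  | [] => LinearMap.id
  | a :: l =>
      LinearMap.mulLeft K (X - C (algebraMap ℝ K a)) ∘ₗ starOp K l +
        LinearMap.mulLeft K (X * (X + 1)) ∘ₗ starOp K l ∘ₗ derivative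

lemma starOp_cons (K : Type*) [Field K] [Algebra ℝ K] (a : ℝ) (l : List ℝ) (p : K[X]) :
    starOp K (a :: l) p = (X - C (algebraMap ℝ K a)) * starOp K l p +
      X * (X + 1) * starOp K l (derivative p) := by
  simp [starOp, mul_assoc]

lemma map_starOp (l : List ℝ) (f : ℝ[X]) :
    (starOp ℝ l f).map (algebraMap ℝ ℂ) = starOp ℂ l (f.map (algebraMap ℝ ℂ)) := by
  induction l generalizing f with
  | nil => simp [starOp]
  | cons a l ih => simp [starOp_cons, ih, derivative_map]

lemma iterate_derivative_X_sub_C_mul (a : ℝ) (k : ℝ[X]) (n : ℕ) :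
    derivative^[n] ((X - C a) * k) =
      (X - C a) * derivative^[n] k + n • derivative^[n - 1] k := by
  rw [sub_mul, iterate_derivative_sub, mul_comm X k, iterate_derivative_mul_X,
    iterate_derivative_C_mul]
  ring

lemma starProd_X_sub_C_mul (f k : ℝ[X]) (a : ℝ) :
    starProd f ((X - C a) * k) =
      (X - C a) * starProd f k + X * (X + 1) * starProd (derivative f) k := by
  have hsplit : starProd f ((X - C a) * k) = (X - C a) * starProd f k +
      ∑ n ∈ Finset.range (f.natDegree + 1), C ((n.factorial : ℝ)⁻¹) * derivative^[n] f *
        (n • derivative^[n - 1] k) * (X * (X + 1)) ^ n := by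
    simp only [starProd, iterate_derivative_X_sub_C_mul, Finset.mul_sum, ← Finset.sum_add_distrib]
    exact Finset.sum_congr rfl fun n _ => by ring
  rw [hsplit, Finset.sum_range_succ']
  congr 1
  rcases Nat.eq_zero_or_pos f.natDegree with h0 | hpos
  · have : derivative f = 0 := derivative_of_natDegree_zero h0
    simp [h0, this, starProd]
  · have hdeg : (derivative f).natDegree + 1 = f.natDegree := by
      rw [natDegree_derivative]; omega
    simp only [starProd, hdeg, Finset.mul_sum, zero_smul, mul_zero, zero_mul, add_zero,
      add_tsub_cancel_right, Function.iterate_succ_apply]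
    refine Finset.sum_congr rfl fun n _ => ?_
    have hfac : C (((n + 1).factorial : ℝ)⁻¹) * ((n + 1 : ℕ) : ℝ[X]) =
        C ((n.factorial : ℝ)⁻¹) := by
      rw [← C_eq_natCast, ← C_mul, Nat.factorial_succ]
      congr 1
      push_cast
      field_simp
    rw [nsmul_eq_mul, ← hfac]
    ring

lemma starProd_C_mul (f k : ℝ[X]) (c : ℝ) : starProd f (C c * k) = C c * starProd f k := by
  simp only [starProd, iterate_derivative_C_mul, Finset.mul_sum]
  exact Finset.sum_congr rfl fun n _ => by ring

lemma starProd_one (f : ℝ[X]) : starProd f 1 = f := by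
  rw [starProd, Finset.sum_range_succ', Finset.sum_eq_zero]
  · simp
  · intro n _
    simp [iterate_derivative_one (Nat.succ_pos n)]

lemma starProd_list_prod (f : ℝ[X]) (l : List ℝ) :
    starProd f (l.map (X - C ·)).prod = starOp ℝ l f := by
  induction l generalizing f with
  | nil => simp [starOp, starProd_one]
  | cons a l ih => simp [starProd_X_sub_C_mul, starOp_cons, ih]

lemma exists_coeff_starOp (l : List ℝ) :
    ∃ c : ℕ → ℝ, (∀ d, 0 < c d) ∧ ∀ d (f : ℝ[X]), f.natDegree ≤ d →
      (starOp ℝ l f).natDegree ≤ d + l.length ∧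
        (starOp ℝ l f).coeff (d + l.length) = c d * f.coeff d := by
  induction l with
  | nil => exact ⟨fun _ => 1, fun _ => one_pos, fun d f hf => by simpa [starOp] using hf⟩
  | cons a l ih =>
    obtain ⟨c, hc, H⟩ := ih
    have hw : (X * (X + 1) : ℝ[X]).natDegree ≤ 2 := by compute_degree
    have hwc : (X * (X + 1) : ℝ[X]).coeff 2 = 1 := by simp [coeff_one]
    have hx : (X - C a).natDegree ≤ 1 := by compute_degree
    have hxc : (X - C a).coeff 1 = 1 := by simp
    refine ⟨fun d => c d + d * c (d - 1), fun d => ?_, fun d f hf => ?_⟩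
    · have := hc d
      have := (hc (d - 1)).le
      positivity
    obtain ⟨hf₁, hf₂⟩ := H d f hf
    have e₁ : d + (l.length + 1) = 1 + (d + l.length) := by omega
    have h₁ : ((X - C a) * starOp ℝ l f).natDegree ≤ d + (l.length + 1) := by
      rw [e₁]; exact natDegree_mul_le_of_le hx hf₁
    have h₂ : ((X - C a) * starOp ℝ l f).coeff (d + (l.length + 1)) = c d * f.coeff d := by
      rw [e₁, coeff_mul_add_eq_of_natDegree_le hx hf₁, hxc, hf₂, one_mul]
    simp only [starOp_cons, List.length_cons, coeff_add, Algebra.algebraMap_self, RingHom.id_apply,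
      h₂]
    cases d with
    | zero =>
      have : derivative f = 0 := derivative_of_natDegree_zero (Nat.le_zero.mp hf)
      simpa [this] using h₁
    | succ d =>
      obtain ⟨hd₁, hd₂⟩ := H d (derivative f)
        ((natDegree_derivative_le f).trans (by omega))
      have e₂ : d + 1 + (l.length + 1) = 2 + (d + l.length) := by omega
      refine ⟨(natDegree_add_le _ _).trans (max_le h₁ ?_), ?_⟩
      · rw [e₂]; exact natDegree_mul_le_of_le hw hd₁
      · rw [e₂, coeff_mul_add_eq_of_natDegree_le hw hd₁, hwc, hd₂, coeff_derivative]
        push_cast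
        ring

lemma natDegree_starOp (l : List ℝ) {f : ℝ[X]} (hf : f ≠ 0) :
    (starOp ℝ l f).natDegree = f.natDegree + l.length := by
  obtain ⟨c, hc, H⟩ := exists_coeff_starOp l
  obtain ⟨h₁, h₂⟩ := H _ f le_rfl
  refine le_antisymm h₁ (le_natDegree_of_ne_zero ?_)
  rw [h₂]
  exact mul_ne_zero (hc _).ne' (leadingCoeff_ne_zero.mpr hf)

/-- A complex polynomial without zeros in the open upper half-plane. -/
def UpperStable (p : ℂ[X]) : Prop :=
  ∀ z : ℂ, 0 < z.im → p.eval z ≠ 0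

lemma Complex.im_inv_neg {z : ℂ} (hz : 0 < z.im) : (z⁻¹).im < 0 := by
  rw [Complex.inv_im]
  exact div_neg_of_neg_of_pos (by linarith)
    (Complex.normSq_pos.mpr fun h => by simp [h] at hz)

lemma UpperStable.im_eval_derivative_div_nonpos {p : ℂ[X]} (hp : UpperStable p) {z : ℂ}
    (hz : 0 < z.im) : ((derivative p).eval z / p.eval z).im ≤ 0 := by
  rw [(IsAlgClosed.splits p).eval_derivative_div_eval_of_ne_zero (hp z hz)]
  change Complex.imAddGroupHom _ ≤ 0
  rw [map_multiset_sum, Multiset.map_map]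
  refine (Multiset.sum_le_card_nsmul _ 0 fun x hx => ?_).trans_eq (smul_zero _)
  obtain ⟨r, hr, rfl⟩ := Multiset.mem_map.mp hx
  have hr' : r.im ≤ 0 := not_lt.mp fun h => hp r h (isRoot_of_mem_roots hr)
  simp only [Function.comp_apply, Complex.coe_imAddGroupHom, one_div]
  exact (Complex.im_inv_neg (by rw [Complex.sub_im]; linarith)).le

lemma UpperStable.derivative_sub {p : ℂ[X]} (hp : UpperStable p) {c : ℂ} (hc : 0 < c.im) :
    UpperStable (derivative p - C c * p) := by
  intro z hz h
  have hpz := hp z hz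
  have : (derivative p).eval z / p.eval z = c := by
    rw [div_eq_iff hpz]
    simpa [sub_eq_zero] using h
  have := hp.im_eval_derivative_div_nonpos hz
  simp_all [not_le.mpr hc]

lemma im_sub_div_mul_neg {a : ℝ} (h₁ : -1 ≤ a) (h₀ : a ≤ 0) {z : ℂ} (hz : 0 < z.im) :
    ((z - a) / (z * (z + 1))).im < 0 := by
  have hz0 : z ≠ 0 := fun h => by simp [h] at hz
  have hz1' : 0 < (z + 1).im := by simpa using hz
  have hz1 : z + 1 ≠ 0 := fun h => by simp [h] at hz1'
  have e : (z - a) / (z * (z + 1)) = ((-a : ℝ) : ℂ) * z⁻¹ + ((1 + a : ℝ) : ℂ) * (z + 1)⁻¹ := by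
    push_cast
    field_simp
    ring
  have i₁ := Complex.im_inv_neg hz
  have i₂ := Complex.im_inv_neg hz1'
  rw [e, Complex.add_im, Complex.im_ofReal_mul, Complex.im_ofReal_mul]
  rcases h₀.lt_or_eq with h | rfl
  · nlinarith
  · simpa using i₂

lemma UpperStable.starOp {l : List ℝ} (hl : ∀ a ∈ l, -1 ≤ a ∧ a ≤ 0) {p : ℂ[X]}
    (hp : UpperStable p) : UpperStable (starOp ℂ l p) := by
  induction l generalizing p with
  | nil => simpa [_root_.starOp] using hp
  | cons a l ih =>
    have ih' := fun {p} => ih (p := p) fun b hb => hl b (List.mem_cons_of_mem a hb)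
    obtain ⟨ha₁, ha₀⟩ := hl a List.mem_cons_self
    intro z hz h
    have hP := ih' hp z hz
    have him :
        ((_root_.starOp ℂ l (derivative p)).eval z / (_root_.starOp ℂ l p).eval z).im ≤ 0 := by
      by_contra! hc
      refine ih' (hp.derivative_sub hc) z hz ?_
      rw [← smul_eq_C_mul, map_sub, map_smul, eval_sub, eval_smul, smul_eq_mul,
        div_mul_cancel₀ _ hP, sub_self]
    have hz0 : z ≠ 0 := fun h => by simp [h] at hz
    have hz1 : z + 1 ≠ 0 := fun h => by simp [eq_neg_of_add_eq_zero_left h] at hz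
    have e : (_root_.starOp ℂ l (derivative p)).eval z / (_root_.starOp ℂ l p).eval z =
        -((z - a) / (z * (z + 1))) := by
      simp only [starOp_cons, eval_add, eval_mul, eval_sub, eval_X, eval_C, eval_one,
        Complex.coe_algebraMap] at h
      field_simp
      linear_combination h
    rw [e, Complex.neg_im] at him
    linarith [im_sub_div_mul_neg ha₁ ha₀ hz]

lemma RealRooted.splits {f : ℝ[X]} (hf : RealRooted f) : f.Splits := by
  refine Splits.of_splits_map (algebraMap ℝ ℂ) (IsAlgClosed.splits _) fun z hz => ?_
  exact ⟨z.re, Complex.ext rfl (hf.2 z (isRoot_of_mem_roots hz)).symm⟩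

lemma RealRooted.upperStable {f : ℝ[X]} (hf : RealRooted f) :
    UpperStable (f.map (algebraMap ℝ ℂ)) :=
  fun z hz h => hz.ne' (hf.2 z h)

lemma RealRooted.of_upperStable {f : ℝ[X]} (hf : UpperStable (f.map (algebraMap ℝ ℂ))) :
    RealRooted f := by
  refine ⟨fun h => hf Complex.I (by simp) (by simp [h]), fun z hz => ?_⟩
  rcases lt_trichotomy z.im 0 with h | h | h
  · refine absurd ?_ (hf (starRingEnd ℂ z) (by simpa using h))
    rw [IsRoot, eval_map_algebraMap] at hz
    rw [eval_map_algebraMap, aeval_conj, hz, map_zero]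
  · exact h
  · exact absurd hz (hf z h)

/-- The argument, in `(0, π)`, of `t + i y - α` for `y > 0`. -/
noncomputable def rootAngle (t y α : ℝ) : ℝ :=
  Real.pi / 2 - Real.arctan ((t - α) / y)

lemma rootAngle_pos (t y α : ℝ) : 0 < rootAngle t y α :=
  sub_pos.mpr (Real.arctan_lt_pi_div_two _)

lemma rootAngle_lt_pi (t y α : ℝ) : rootAngle t y α < Real.pi := by
  have := Real.neg_pi_div_two_lt_arctan ((t - α) / y)
  unfold rootAngle
  linarith

lemma rootAngle_mono (t : ℝ) {y : ℝ} (hy : 0 < y) : Monotone (rootAngle t y) := by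
  intro α β h
  unfold rootAngle
  gcongr

lemma exists_sub_eq_mul_exp_rootAngle (t α : ℝ) {y : ℝ} (hy : 0 < y) :
    ∃ R : ℝ, 0 < R ∧ (⟨t, y⟩ : ℂ) - α = R * Complex.exp (rootAngle t y α * Complex.I) := by
  have hs : 0 < √(1 + ((t - α) / y) ^ 2) := by positivity
  refine ⟨y * √(1 + ((t - α) / y) ^ 2), by positivity, ?_⟩
  rw [Complex.exp_mul_I, ← Complex.ofReal_cos, ← Complex.ofReal_sin, rootAngle,
    Real.cos_pi_div_two_sub, Real.sin_pi_div_two_sub, Real.sin_arctan, Real.cos_arctan]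
  apply Complex.ext
  · simp
    field_simp
  · simp
    field_simp

/-- The sum of the arguments of `t + i y - α` over the zeros `α` of `f`. -/
noncomputable def angleSum (f : ℝ[X]) (t y : ℝ) : ℝ :=
  (f.roots.map (rootAngle t y)).sum

lemma RealRooted.exists_eval_eq {f : ℝ[X]} (hf : RealRooted f) (t : ℝ) {y : ℝ} (hy : 0 < y) :
    ∃ R : ℝ, 0 < R ∧ (f.map (algebraMap ℝ ℂ)).eval ⟨t, y⟩ =
      f.leadingCoeff * (R * Complex.exp (angleSum f t y * Complex.I)) := by
  have key : ∀ A : Multiset ℝ, ∃ R : ℝ, 0 < R ∧ (A.map fun α : ℝ => (⟨t, y⟩ : ℂ) - α).prod =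
      R * Complex.exp ((A.map (rootAngle t y)).sum * Complex.I) := by
    intro A
    induction A using Multiset.induction_on with
    | empty => exact ⟨1, one_pos, by simp⟩
    | cons α A ih =>
      obtain ⟨R, hR, h⟩ := ih
      obtain ⟨S, hS, h'⟩ := exists_sub_eq_mul_exp_rootAngle t α hy
      refine ⟨S * R, by positivity, ?_⟩
      rw [Multiset.map_cons, Multiset.prod_cons, h, h', Multiset.map_cons, Multiset.sum_cons]
      push_cast
      rw [add_mul, Complex.exp_add]
      ring
  obtain ⟨R, hR, h⟩ := key f.roots
  refine ⟨R, hR, ?_⟩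
  rw [angleSum, ← h]
  conv_lhs => rw [hf.splits.eq_prod_roots]
  simp [eval_multiset_prod, Polynomial.map_multiset_prod, Multiset.map_map]

lemma exists_im_eval_div_eq {f g : ℝ[X]} (hf : RealRooted f) (hg : RealRooted g) (t : ℝ) {y : ℝ}
    (hy : 0 < y) : ∃ R : ℝ, 0 < R ∧
      ((g.map (algebraMap ℝ ℂ)).eval ⟨t, y⟩ / (f.map (algebraMap ℝ ℂ)).eval ⟨t, y⟩).im =
        g.leadingCoeff / f.leadingCoeff * (R * Real.sin (angleSum g t y - angleSum f t y)) := by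
  obtain ⟨R, hR, hR'⟩ := hf.exists_eval_eq t hy
  obtain ⟨S, hS, hS'⟩ := hg.exists_eval_eq t hy
  refine ⟨S / R, by positivity, ?_⟩
  have hlc : f.leadingCoeff ≠ 0 := leadingCoeff_ne_zero.mpr hf.1
  have e : (g.leadingCoeff * (S * Complex.exp (angleSum g t y * Complex.I)) : ℂ) /
      (f.leadingCoeff * (R * Complex.exp (angleSum f t y * Complex.I))) =
      ((g.leadingCoeff / f.leadingCoeff * (S / R) : ℝ) : ℂ) *
        Complex.exp ((angleSum g t y - angleSum f t y : ℝ) * Complex.I) := by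
    push_cast
    rw [sub_mul, Complex.exp_sub]
    field_simp
  rw [hR', hS', e, Complex.im_ofReal_mul, Complex.exp_ofReal_mul_I_im]
  ring

lemma List.sum_map_eq_sum_range_getD (l : List ℝ) (φ : ℝ → ℝ) :
    (l.map φ).sum = ∑ i ∈ Finset.range l.length, φ (l.getD i 0) := by
  induction l with
  | nil => simp
  | cons a l ih => simp [Finset.sum_range_succ', ih, add_comm]

lemma coe_sortedRoots (f : ℝ[X]) : (sortedRoots f : Multiset ℝ) = f.roots :=
  Multiset.sort_eq _ _

lemma RealRooted.length_sortedRoots {f : ℝ[X]} (hf : RealRooted f) :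
    (sortedRoots f).length = f.natDegree := by
  rw [sortedRoots, Multiset.length_sort, hf.splits.natDegree_eq_card_roots]

lemma RealRooted.angleSum_eq {f : ℝ[X]} (hf : RealRooted f) (t y : ℝ) :
    angleSum f t y =
      ∑ i ∈ Finset.range f.natDegree, rootAngle t y ((sortedRoots f).getD i 0) := by
  rw [angleSum, ← coe_sortedRoots, Multiset.map_coe, Multiset.sum_coe,
    List.sum_map_eq_sum_range_getD, hf.length_sortedRoots]

lemma Interlaces.im_eval_div_neg {f g : ℝ[X]} (h : Interlaces g f) {z : ℂ} (hz : 0 < z.im) :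
    ((f.leadingCoeff / g.leadingCoeff : ℝ) *
      ((g.map (algebraMap ℝ ℂ)).eval z / (f.map (algebraMap ℝ ℂ)).eval z)).im < 0 := by
  obtain ⟨hf, hg, hdeg, hi⟩ := h
  obtain ⟨t, y⟩ := z
  obtain ⟨R, hR, hR'⟩ := exists_im_eval_div_eq hf hg t hz
  have hlf : f.leadingCoeff ≠ 0 := leadingCoeff_ne_zero.mpr hf.1
  have hlg : g.leadingCoeff ≠ 0 := leadingCoeff_ne_zero.mpr hg.1
  rw [Complex.im_ofReal_mul, hR', ← mul_assoc, div_mul_div_cancel₀ hlg, div_self hlf, one_mul]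
  have hlower : -Real.pi < angleSum g t y - angleSum f t y := by
    rw [hf.angleSum_eq, hg.angleSum_eq, hdeg, Finset.sum_range_succ]
    have := Finset.sum_le_sum fun i hi' => rootAngle_mono t hz (hi i (Finset.mem_range.mp hi')).1
    linarith [rootAngle_lt_pi t y ((sortedRoots f).getD g.natDegree 0)]
  have hupper : angleSum g t y - angleSum f t y < 0 := by
    rw [hf.angleSum_eq, hg.angleSum_eq, hdeg, Finset.sum_range_succ']
    have := Finset.sum_le_sum fun i hi' => rootAngle_mono t hz (hi i (Finset.mem_range.mp hi')).2
    linarith [rootAngle_pos t y ((sortedRoots f).getD 0 0)]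
  exact mul_neg_of_pos_of_neg hR (Real.sin_neg_of_neg_of_neg_pi_lt hupper hlower)

open Filter Topology

lemma tendsto_rootAngle_atTop (t α : ℝ) :
    Tendsto (fun y => rootAngle t y α) atTop (𝓝 (Real.pi / 2)) := by
  have h : Tendsto (fun y => (t - α) / y) atTop (𝓝 0) := tendsto_const_nhds.div_atTop tendsto_id
  simpa [rootAngle] using ((Real.continuous_arctan.tendsto 0).comp h).const_sub (Real.pi / 2)

lemma tendsto_rootAngle_zero {t α : ℝ} (h : α ≠ t) :
    Tendsto (fun y => rootAngle t y α) (𝓝[>] 0) (𝓝 (if t < α then Real.pi else 0)) := by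
  simp only [rootAngle, div_eq_mul_inv (t - α)]
  split_ifs with hlt
  · have := (Real.tendsto_arctan_atBot.mono_right nhdsWithin_le_nhds).comp
      (tendsto_inv_nhdsGT_zero.const_mul_atTop_of_neg (sub_neg.mpr hlt))
    simpa using this.const_sub (Real.pi / 2)
  · have := (Real.tendsto_arctan_atTop.mono_right nhdsWithin_le_nhds).comp
      (tendsto_inv_nhdsGT_zero.const_mul_atTop (sub_pos.mpr (lt_of_le_of_ne (not_lt.mp hlt) h)))
    simpa using this.const_sub (Real.pi / 2)

lemma continuousOn_angleSum (f : ℝ[X]) (t : ℝ) : ContinuousOn (angleSum f t) (Set.Ioi 0) := by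
  intro y hy
  refine tendsto_multiset_sum _ fun α _ => ?_
  have : ContinuousAt (fun y => rootAngle t y α) y :=
    continuousAt_const.sub (Real.continuous_arctan.continuousAt.comp
      (continuousAt_const.div continuousAt_id (ne_of_gt hy)))
  exact this.continuousWithinAt

lemma RealRooted.tendsto_angleSum_atTop {f : ℝ[X]} (hf : RealRooted f) (t : ℝ) :
    Tendsto (angleSum f t) atTop (𝓝 (f.natDegree * (Real.pi / 2))) := by
  have := tendsto_multiset_sum f.roots fun α _ => tendsto_rootAngle_atTop t α
  rw [Multiset.map_const', Multiset.sum_replicate, nsmul_eq_mul,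
    ← hf.splits.natDegree_eq_card_roots] at this
  exact this

lemma tendsto_angleSum_zero {f : ℝ[X]} {t : ℝ} (ht : t ∉ f.roots) :
    Tendsto (angleSum f t) (𝓝[>] 0) (𝓝 ((sortedRoots f).countP (t < ·) * Real.pi)) := by
  have key : ∀ l : List ℝ, (l.map fun α => if t < α then Real.pi else 0).sum =
      l.countP (t < ·) * Real.pi := by
    intro l
    induction l with
    | nil => simp
    | cons a l ih =>
      rw [List.map_cons, List.sum_cons, ih, List.countP_cons]
      by_cases h : t < a
      · simp [h]
        ring
      · simp [h]
  have := tendsto_multiset_sum f.roots fun α hα =>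
    tendsto_rootAngle_zero (t := t) (α := α) fun h => ht (h ▸ hα)
  rw [← key, ← Multiset.sum_coe, ← Multiset.map_coe, coe_sortedRoots]
  exact this

/-- If `g / f` maps the upper half-plane to the lower one, up to a real factor, then, to the right
of any point that is not a zero, `f` has as many zeros as `g` or one more. -/
lemma countP_sortedRoots_le {f g : ℝ[X]} (hf : RealRooted f) (hg : RealRooted g)
    (hdeg : f.natDegree = g.natDegree + 1) {u : ℝ}
    (him : ∀ z : ℂ, 0 < z.im →
      (u * ((g.map (algebraMap ℝ ℂ)).eval z / (f.map (algebraMap ℝ ℂ)).eval z)).im < 0)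
    {t : ℝ} (htf : t ∉ f.roots) (htg : t ∉ g.roots) :
    (sortedRoots g).countP (t < ·) ≤ (sortedRoots f).countP (t < ·) ∧
      (sortedRoots f).countP (t < ·) ≤ (sortedRoots g).countP (t < ·) + 1 := by
  set Φ : ℝ → ℝ := fun y => angleSum g t y - angleSum f t y
  have hpi := Real.pi_pos
  have hcont : ContinuousOn Φ (Set.Ioi 0) :=
    (continuousOn_angleSum g t).sub (continuousOn_angleSum f t)
  have htop : Tendsto Φ atTop (𝓝 (-(Real.pi / 2))) := by
    convert (hg.tendsto_angleSum_atTop t).sub (hf.tendsto_angleSum_atTop t) using 2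
    rw [hdeg]
    push_cast
    ring
  have hsign : ∀ y, 0 < y →
      u * (g.leadingCoeff / f.leadingCoeff) * Real.sin (Φ y) < 0 := by
    intro y hy
    obtain ⟨R, hR, hR'⟩ := exists_im_eval_div_eq hf hg t hy
    have := him ⟨t, y⟩ hy
    rw [Complex.im_ofReal_mul, hR'] at this
    refine neg_of_mul_neg_right (a := R) ?_ hR.le
    linarith
  obtain ⟨y₁, hy₁, hΦ₁⟩ : ∃ y, 0 < y ∧ Φ y ∈ Set.Ioo (-Real.pi) 0 :=
    ((eventually_gt_atTop 0).and (htop.eventually (Ioo_mem_nhds (by linarith)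
      (by linarith)))).exists
  have hsin : ∀ y, 0 < y → Real.sin (Φ y) ≠ 0 := fun y hy h => by
    simpa [h] using hsign y hy
  have hpre : (Φ '' Set.Ioi 0).OrdConnected :=
    (isPreconnected_Ioi.image Φ hcont).ordConnected
  have hmem : ∀ y, 0 < y → Φ y ∈ Set.Icc (-Real.pi) 0 := by
    intro y hy
    constructor
    · by_contra! hlt
      obtain ⟨w, hw, hw'⟩ := hpre.out (Set.mem_image_of_mem Φ hy) (Set.mem_image_of_mem Φ hy₁)
        ⟨hlt.le, hΦ₁.1.le⟩
      exact hsin w hw (by simp [hw'])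
    · by_contra! hlt
      obtain ⟨w, hw, hw'⟩ := hpre.out (Set.mem_image_of_mem Φ hy₁) (Set.mem_image_of_mem Φ hy)
        ⟨hΦ₁.2.le, hlt.le⟩
      exact hsin w hw (by simp [hw'])
  have hzero := (tendsto_angleSum_zero htg).sub (tendsto_angleSum_zero htf)
  obtain ⟨hl, hu⟩ := isClosed_Icc.mem_of_tendsto hzero
    (eventually_mem_nhdsWithin.mono fun y hy => hmem y hy)
  rw [← sub_mul] at hl hu
  constructor
  · have := nonpos_of_mul_nonpos_left hu hpi
    exact_mod_cast sub_nonpos.mp this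
  · have : ((sortedRoots f).countP (t < ·) : ℝ) ≤ (sortedRoots g).countP (t < ·) + 1 := by
      by_contra! hlt
      nlinarith
    exact_mod_cast this

lemma List.Pairwise.countP_lt_of_lt_getD {l : List ℝ} (hl : l.Pairwise (· ≤ ·)) {i : ℕ} {t : ℝ}
    (hi : i < l.length) (ht : t < l.getD i 0) : l.length ≤ l.countP (t < ·) + i := by
  induction l generalizing i with
  | nil => simp at hi
  | cons a l ih =>
    rw [List.pairwise_cons] at hl
    cases i with
    | zero =>
      have hall : (a :: l).countP (t < ·) = (a :: l).length := by
        rw [List.countP_eq_length]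
        simp only [List.getD_cons_zero] at ht
        intro b hb
        rcases List.mem_cons.mp hb with rfl | hb
        · simpa using ht
        · simpa using ht.trans_le (hl.1 b hb)
      omega
    | succ i =>
      have := ih hl.2 (by simpa using hi) (by simpa using ht)
      simp only [List.countP_cons, List.length_cons]
      omega

lemma List.Pairwise.countP_lt_of_getD_le {l : List ℝ} (hl : l.Pairwise (· ≤ ·)) {i : ℕ} {t : ℝ}
    (hi : i < l.length) (ht : l.getD i 0 ≤ t) : l.countP (t < ·) + i + 1 ≤ l.length := by
  induction l generalizing i with
  | nil => simp at hi
  | cons a l ih =>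
    rw [List.pairwise_cons] at hl
    have ha : a ≤ t := by
      cases i with
      | zero => simpa using ht
      | succ i =>
        have hi' : i < l.length := by simpa using hi
        refine (hl.1 (l.getD i 0) ?_).trans (by simpa using ht)
        rw [List.getD_eq_getElem _ _ hi']
        exact List.getElem_mem hi'
    rw [List.countP_cons_of_neg (by simpa using ha)]
    cases i with
    | zero =>
      have := List.countP_le_length (p := (t < ·)) (l := l)
      simp only [List.length_cons]
      omega
    | succ i =>
      have := ih hl.2 (by simpa using hi) (by simpa using ht)
      simp only [List.length_cons]
      omega

lemma exists_between_notMem_roots (f g : ℝ[X]) {a b : ℝ} (hab : a < b) :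
    ∃ t, a < t ∧ t < b ∧ t ∉ f.roots ∧ t ∉ g.roots := by
  obtain ⟨t, ht, htn⟩ := (Set.Ioo_infinite hab).exists_notMem_finset
    (f.roots.toFinset ∪ g.roots.toFinset)
  simp only [Finset.mem_union, Multiset.mem_toFinset, not_or] at htn
  exact ⟨t, ht.1, ht.2, htn⟩

lemma Interlaces.of_im_eval_div_neg {f g : ℝ[X]} (hf : RealRooted f) (hg : RealRooted g)
    (hdeg : f.natDegree = g.natDegree + 1) {u : ℝ}
    (him : ∀ z : ℂ, 0 < z.im →
      (u * ((g.map (algebraMap ℝ ℂ)).eval z / (f.map (algebraMap ℝ ℂ)).eval z)).im < 0) :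
    Interlaces g f := by
  have hsf : (sortedRoots f).Pairwise (· ≤ ·) := Multiset.pairwise_sort _ _
  have hsg : (sortedRoots g).Pairwise (· ≤ ·) := Multiset.pairwise_sort _ _
  have hlf := hf.length_sortedRoots
  have hlg := hg.length_sortedRoots
  refine ⟨hf, hg, hdeg, fun i hi => ⟨?_, ?_⟩⟩
  · by_contra! hlt
    obtain ⟨t, hgt, hft, htf, htg⟩ := exists_between_notMem_roots f g hlt
    have h₁ := hsf.countP_lt_of_lt_getD (by omega) hft
    have h₂ := hsg.countP_lt_of_getD_le (by omega) hgt.le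
    have h₃ := (countP_sortedRoots_le hf hg hdeg him htf htg).2
    omega
  · by_contra! hlt
    obtain ⟨t, hft, hgt, htf, htg⟩ := exists_between_notMem_roots f g hlt
    have h₁ := hsg.countP_lt_of_lt_getD (by omega) hgt
    have h₂ := hsf.countP_lt_of_getD_le (by omega) hft.le
    have h₃ := (countP_sortedRoots_le hf hg hdeg him htf htg).1
    omega

lemma RealRooted.starOp {l : List ℝ} (hl : ∀ a ∈ l, -1 ≤ a ∧ a ≤ 0) {f : ℝ[X]}
    (hf : RealRooted f) : RealRooted (starOp ℝ l f) :=
  .of_upperStable (map_starOp l f ▸ hf.upperStable.starOp hl)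

lemma Interlaces.starOp {l : List ℝ} (hl : ∀ a ∈ l, -1 ≤ a ∧ a ≤ 0) {f g : ℝ[X]}
    (h : Interlaces g f) : Interlaces (starOp ℝ l g) (starOp ℝ l f) := by
  obtain ⟨hf, hg, hdeg, -⟩ := id h
  refine .of_im_eval_div_neg (hf.starOp hl) (hg.starOp hl) ?_
    (u := f.leadingCoeff / g.leadingCoeff) fun z hz => ?_
  · rw [natDegree_starOp l hf.1, natDegree_starOp l hg.1]
    omega
  set u : ℝ := f.leadingCoeff / g.leadingCoeff
  have hu : u ≠ 0 :=
    div_ne_zero (leadingCoeff_ne_zero.mpr hf.1) (leadingCoeff_ne_zero.mpr hg.1)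
  rw [map_starOp, map_starOp]
  set p := f.map (algebraMap ℝ ℂ)
  set q := g.map (algebraMap ℝ ℂ)
  by_contra! hc
  set c : ℂ := u * ((_root_.starOp ℂ l q).eval z / (_root_.starOp ℂ l p).eval z) with hcdef
  have hPz := hf.upperStable.starOp hl z hz
  -- `u q / p` takes values in the open lower half-plane, so it omits the value `c`.
  have hstable : UpperStable ((u : ℂ) • q - c • p) := by
    intro w hw hw0
    have hpw : p.eval w ≠ 0 := hf.upperStable w hw
    have := h.im_eval_div_neg hw
    rw [show ((u : ℂ) * (q.eval w / p.eval w)) = c by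
      rw [← mul_div_assoc, div_eq_iff hpw]
      simpa [sub_eq_zero] using hw0] at this
    linarith
  refine hstable.starOp hl z hz ?_
  rw [map_sub, map_smul, map_smul, eval_sub, eval_smul, eval_smul, smul_eq_mul, smul_eq_mul, hcdef,
    mul_assoc, div_mul_cancel₀ _ hPz, sub_self]

lemma sortedRoots_C_mul {c : ℝ} (hc : c ≠ 0) (f : ℝ[X]) :
    sortedRoots (C c * f) = sortedRoots f := by
  rw [sortedRoots, roots_C_mul f hc, sortedRoots]

lemma RealRooted.C_mul {c : ℝ} (hc : c ≠ 0) {f : ℝ[X]} (hf : RealRooted f) :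
    RealRooted (C c * f) :=
  ⟨mul_ne_zero (C_ne_zero.mpr hc) hf.1, fun z hz => hf.2 z (by simpa [hc] using hz)⟩

lemma Interlaces.C_mul {c : ℝ} (hc : c ≠ 0) {f g : ℝ[X]} (h : Interlaces g f) :
    Interlaces (C c * g) (C c * f) := by
  obtain ⟨hf, hg, hdeg, hi⟩ := h
  refine ⟨hf.C_mul hc, hg.C_mul hc, ?_⟩
  rw [natDegree_C_mul hc, natDegree_C_mul hc, sortedRoots_C_mul hc, sortedRoots_C_mul hc]
  exact ⟨hdeg, hi⟩

/-- Theorem 2.12 (a) for the product `★`: if `h` is nonzero with all complex zeros in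
`[-1,0]` and `f` is real-rooted, then `f ★ h` is real-rooted or zero, and `g ⪯ f` implies
`g ★ h ⪯ f ★ h`. -/
theorem star_real_rooted_and_interlaces (h f : Polynomial ℝ)
    (hh0 : h ≠ 0)
    (hh : ∀ z : ℂ, (h.map (algebraMap ℝ ℂ)).IsRoot z → z.im = 0 ∧ -1 ≤ z.re ∧ z.re ≤ 0)
    (hf : RealRooted f) :
    (starProd f h = 0 ∨ RealRooted (starProd f h)) ∧
    (∀ g : Polynomial ℝ, RealRooted g → Interlaces g f →
      Interlaces (starProd g h) (starProd f h)) := by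
  have hhr : RealRooted h := ⟨hh0, fun z hz => (hh z hz).1⟩
  have hlc : h.leadingCoeff ≠ 0 := leadingCoeff_ne_zero.mpr hh0
  have hl : ∀ a ∈ sortedRoots h, -1 ≤ a ∧ a ≤ 0 := by
    intro a ha
    have hroot := isRoot_of_mem_roots ((Multiset.mem_sort _).mp ha)
    simpa using (hh a (hroot.map (f := algebraMap ℝ ℂ))).2
  have hstar (p : ℝ[X]) : starProd p h = C h.leadingCoeff * starOp ℝ (sortedRoots h) p := by
    conv_lhs => rw [hhr.splits.eq_prod_roots, ← coe_sortedRoots, Multiset.map_coe,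
      Multiset.prod_coe, starProd_C_mul, starProd_list_prod]
  rw [hstar]
  refine ⟨Or.inr ((hf.starOp hl).C_mul hlc), fun g _ hgf => ?_⟩
  rw [hstar]
  exact (hgf.starOp hl).C_mul hlc
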